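/- There is an absolute constant C such that for every d ∈ ℕ with d ≥ 1, every η ∈ [0,1]², and all Borel probability measures p, q on [0,1]²: W2(p,q)² ≤ C·( 2^{−2⌈log₂ d⌉} + Σ_{k=1}^{⌈log₂ d⌉} 2^{−2k} · Σ_{cells A ∈ Q^k(η)} |p(A) − q(A)| ). -/

import Mathlib

open MeasureTheory

noncomputable section

/-- A coupling of `μ` and `ν`: a measure on the product whose marginals are `μ` and `ν`. -/
def IsCoupling {α β : Type*} [MeasurableSpace α] [MeasurableSpace β]
    (γ : Measure (α × β)) (μ : Measure α) (ν : Measure β) : Prop :=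
  γ.map Prod.fst = μ ∧ γ.map Prod.snd = ν

/-- The optimal transport cost between `μ` and `ν` for the cost function `cost`. -/
def transportCost {α β : Type*} [MeasurableSpace α] [MeasurableSpace β]
    (cost : α → β → ℝ) (μ : Measure α) (ν : Measure β) : ℝ :=
  sInf {c : ℝ | ∃ γ : Measure (α × β), IsProbabilityMeasure γ ∧ IsCoupling γ μ ν ∧
    c = ∫ z, cost z.1 z.2 ∂γ}

/-- Euclidean distance on `ℝ²` (represented as `ℝ × ℝ`). -/
def eucDist (x y : ℝ × ℝ) : ℝ := Real.sqrt ((x.1 - y.1) ^ 2 + (x.2 - y.2) ^ 2)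

/-- Wasserstein-1 distance on `ℝ²` with Euclidean cost. -/
def W1 (μ ν : Measure (ℝ × ℝ)) : ℝ := transportCost eucDist μ ν

/-- Wasserstein-2 distance on `ℝ²` with Euclidean cost. -/
def W2 (μ ν : Measure (ℝ × ℝ)) : ℝ :=
  Real.sqrt (transportCost (fun x y => (x.1 - y.1) ^ 2 + (x.2 - y.2) ^ 2) μ ν)

/-- Wasserstein-1 distance on `ℝ` with cost `|x - y|`. -/
def W1R (μ ν : Measure ℝ) : ℝ := transportCost (fun x y => |x - y|) μ ν

/-- Wasserstein-2 distance on `ℝ` with cost `|x - y|`. -/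
def W2R (μ ν : Measure ℝ) : ℝ :=
  Real.sqrt (transportCost (fun x y => (x - y) ^ 2) μ ν)

/-- The unit square `[0,1]² ⊆ ℝ²`. -/
def unitSq : Set (ℝ × ℝ) := Set.Icc 0 1 ×ˢ Set.Icc 0 1

/-- The cell of the grid `Q^k(η)` on `[0,1]²` with index `(i,j) ∈ ℤ²`: the grid has mesh
`2⁻ᵏ` in each coordinate and is centered at `η`, i.e. cut points are `η₁ + m·2⁻ᵏ` and
`η₂ + m·2⁻ᵏ` for `m ∈ ℤ`. -/
def gridCell (k : ℕ) (η : ℝ × ℝ) (ij : ℤ × ℤ) : Set (ℝ × ℝ) :=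
  {u | u ∈ unitSq ∧ ⌊(2 : ℝ) ^ k * (u.1 - η.1)⌋ = ij.1 ∧ ⌊(2 : ℝ) ^ k * (u.2 - η.2)⌋ = ij.2}

lemma aux_cell {X : Type*} [MeasurableSpace X] (μ ν : Measure X) [IsFiniteMeasure μ]
    [IsFiniteMeasure ν] (h : μ Set.univ ≤ ν Set.univ) :
    ∃ (γ : Measure (X × X)) (ν' : Measure X), γ.map Prod.fst = μ ∧ γ.map Prod.snd + ν' = ν := by
  by_cases h0 : ν Set.univ = 0
  · have hm : μ Set.univ = 0 := le_antisymm (h0 ▸ h) zero_le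
    rw [Measure.measure_univ_eq_zero] at h0 hm
    exact ⟨0, 0, by simp [hm], by simp [h0]⟩
  have ht : ν Set.univ ≠ ⊤ := measure_ne_top _ _
  refine ⟨(ν Set.univ)⁻¹ • μ.prod ν, (1 - (ν Set.univ)⁻¹ * μ Set.univ) • ν, ?_, ?_⟩
  · rw [Measure.map_smul, Measure.map_fst_prod, smul_smul, ENNReal.inv_mul_cancel h0 ht, one_smul]
  · rw [Measure.map_smul, Measure.map_snd_prod, smul_smul, ← add_smul, add_tsub_cancel_of_le,
      one_smul]
    calc (ν Set.univ)⁻¹ * μ Set.univ ≤ (ν Set.univ)⁻¹ * ν Set.univ := by gcongr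
      _ = 1 := ENNReal.inv_mul_cancel h0 ht

lemma aux_cell2 {X : Type*} [MeasurableSpace X] (μ ν : Measure X) [IsFiniteMeasure μ]
    [IsFiniteMeasure ν] :
    ∃ (γ : Measure (X × X)) (μ' ν' : Measure X), γ.map Prod.fst + μ' = μ ∧
      γ.map Prod.snd + ν' = ν ∧ (μ' = 0 ∨ ν' = 0) := by
  rcases le_total (μ Set.univ) (ν Set.univ) with h | h
  · obtain ⟨γ, ν', h1, h2⟩ := aux_cell μ ν h
    exact ⟨γ, 0, ν', by simpa using h1, h2, Or.inl rfl⟩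
  · obtain ⟨γ, μ', h1, h2⟩ := aux_cell ν μ h
    refine ⟨γ.map Prod.swap, μ', 0, ?_, ?_, Or.inr rfl⟩
    · rw [Measure.map_map measurable_fst measurable_swap]; exact h2
    · rw [Measure.map_map measurable_snd measurable_swap, add_zero]; exact h1

lemma aux_part {X ι : Type*} [MeasurableSpace X] [Countable ι] [MeasurableSpace ι]
    [MeasurableSingletonClass ι] (f : X → ι) (hf : Measurable f)
    (μ ν : Measure X) [IsFiniteMeasure μ] [IsFiniteMeasure ν] :
    ∃ (γ : Measure (X × X)) (μ' ν' : Measure X), γ.map Prod.fst + μ' = μ ∧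
      γ.map Prod.snd + ν' = ν ∧ (∀ᵐ z ∂γ, f z.1 = f z.2) ∧
      (∀ i, μ' (f ⁻¹' {i}) = 0 ∨ ν' (f ⁻¹' {i}) = 0) := by
  have hA : ∀ i, MeasurableSet (f ⁻¹' {i}) := fun i => hf (measurableSet_singleton i)
  choose γ μ' ν' h1 h2 h3 using fun i : ι =>
    aux_cell2 (μ.restrict (f ⁻¹' {i})) (ν.restrict (f ⁻¹' {i}))
  have key : ∀ m : Measure X, Measure.sum (fun i => m.restrict (f ⁻¹' {i})) = m := by
    intro m
    rw [← Measure.restrict_iUnion _ hA]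
    · have : (⋃ i, f ⁻¹' {i}) = Set.univ := by ext x; simp
      rw [this, Measure.restrict_univ]
    · intro i j hij
      exact Disjoint.preimage _ (by simpa using hij)
  have o1 : ∀ i, (γ i).map Prod.fst ≤ μ.restrict (f ⁻¹' {i}) := fun i => by
    rw [← h1 i]; exact Measure.le_add_right le_rfl
  have o2 : ∀ i, (γ i).map Prod.snd ≤ ν.restrict (f ⁻¹' {i}) := fun i => by
    rw [← h2 i]; exact Measure.le_add_right le_rfl
  have o3 : ∀ i, μ' i ≤ μ.restrict (f ⁻¹' {i}) := fun i => by
    rw [← h1 i]; exact Measure.le_add_left le_rfl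
  have o4 : ∀ i, ν' i ≤ ν.restrict (f ⁻¹' {i}) := fun i => by
    rw [← h2 i]; exact Measure.le_add_left le_rfl
  have r : ∀ (m : Measure X) i j, i ≠ j → m.restrict (f ⁻¹' {i}) (f ⁻¹' {j}) = 0 := by
    intro m i j hij
    rw [Measure.restrict_apply (hA j)]
    have : f ⁻¹' {j} ∩ f ⁻¹' {i} = ∅ := by
      ext x; simp; intro h h'; exact hij (h'.symm.trans h)
    simp [this]
  refine ⟨Measure.sum γ, Measure.sum μ', Measure.sum ν', ?_, ?_, ?_, ?_⟩
  · rw [Measure.map_sum measurable_fst.aemeasurable, Measure.sum_add_sum]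
    simp_rw [h1]; exact key μ
  · rw [Measure.map_sum measurable_snd.aemeasurable, Measure.sum_add_sum]
    simp_rw [h2]; exact key ν
  · rw [Measure.ae_sum_iff]
    intro i
    have e1 : ∀ᵐ x ∂((γ i).map Prod.fst), f x = i :=
      (Measure.absolutelyContinuous_of_le (o1 i)).ae_le (ae_restrict_mem (hA i))
    have e2 : ∀ᵐ x ∂((γ i).map Prod.snd), f x = i :=
      (Measure.absolutelyContinuous_of_le (o2 i)).ae_le (ae_restrict_mem (hA i))
    have e1' := ae_of_ae_map measurable_fst.aemeasurable e1
    have e2' := ae_of_ae_map measurable_snd.aemeasurable e2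
    filter_upwards [e1', e2'] with z a b
    rw [a, b]
  · intro i
    have z1 : ∀ j ≠ i, μ' j (f ⁻¹' {i}) = 0 := fun j hj =>
      le_antisymm ((o3 j _).trans (r μ j i hj).le) zero_le
    have z2 : ∀ j ≠ i, ν' j (f ⁻¹' {i}) = 0 := fun j hj =>
      le_antisymm ((o4 j _).trans (r ν j i hj).le) zero_le
    rw [Measure.sum_apply _ (hA i), Measure.sum_apply _ (hA i), tsum_eq_single i z1,
      tsum_eq_single i z2]
    rcases h3 i with h | h
    · left; simp [h]
    · right; simp [h]

def auxW (k : ℕ) : ENNReal := ENNReal.ofReal (1 / 2 ^ (2 * k))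

lemma auxW_succ (k : ℕ) : auxW k = 4 * auxW (k + 1) := by
  unfold auxW
  rw [show (4 : ENNReal) = ENNReal.ofReal 4 by simp, ← ENNReal.ofReal_mul (by norm_num)]
  congr 1
  rw [mul_add, pow_add]
  field_simp; norm_num

def auxF (η : ℝ × ℝ) (k : ℕ) (u : ℝ × ℝ) : ℤ × ℤ :=
  (⌊(2 : ℝ) ^ k * (u.1 - η.1)⌋, ⌊(2 : ℝ) ^ k * (u.2 - η.2)⌋)

lemma auxF_meas (η : ℝ × ℝ) (k : ℕ) : Measurable (auxF η k) := by
  unfold auxF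
  refine Measurable.prodMk ?_ ?_
  · exact Int.measurable_floor.comp (by fun_prop)
  · exact Int.measurable_floor.comp (by fun_prop)

lemma aux_floor (k : ℕ) (t : ℝ) : ⌊(2 : ℝ) ^ k * t⌋ = ⌊(2 : ℝ) ^ (k + 1) * t⌋ / 2 := by
  have h := Int.floor_eq_iff.1 (rfl : ⌊(2 : ℝ) ^ (k + 1) * t⌋ = _)
  set n := ⌊(2 : ℝ) ^ (k + 1) * t⌋
  rw [Int.floor_eq_iff]
  rw [pow_succ] at h
  have h1 : 2 * (n / 2) ≤ n := by omega
  have h2 : n + 1 ≤ 2 * (n / 2) + 2 := by omega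
  have h1' : 2 * ((n / 2 : ℤ) : ℝ) ≤ n := by exact_mod_cast h1
  have h2' : (n : ℝ) + 1 ≤ 2 * ((n / 2 : ℤ) : ℝ) + 2 := by exact_mod_cast h2
  constructor <;> nlinarith [h.1, h.2]

lemma auxF_nested (η : ℝ × ℝ) (j n : ℕ) (x y : ℝ × ℝ)
    (h : auxF η (j + n) x = auxF η (j + n) y) : auxF η j x = auxF η j y := by
  induction n with
  | zero => exact h
  | succ n ih =>
    apply ih
    unfold auxF at h ⊢
    rw [Prod.mk.injEq] at h ⊢
    rw [← add_assoc] at h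
    simp only [aux_floor (j + n)]
    rw [h.1, h.2]; exact ⟨rfl, rfl⟩

def auxC (z : (ℝ × ℝ) × (ℝ × ℝ)) : ℝ := (z.1.1 - z.2.1) ^ 2 + (z.1.2 - z.2.2) ^ 2

lemma aux_floor_close (k : ℕ) (s t a : ℝ)
    (h : ⌊(2 : ℝ) ^ k * (s - a)⌋ = ⌊(2 : ℝ) ^ k * (t - a)⌋) :
    (s - t) ^ 2 ≤ 1 / 2 ^ (2 * k) := by
  have := Int.abs_sub_lt_one_of_floor_eq_floor h
  have h2 : (2 : ℝ) ^ k * (s - a) - 2 ^ k * (t - a) = 2 ^ k * (s - t) := by ring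
  rw [h2] at this
  rw [le_div_iff₀ (by positivity)]
  have h3 : (2 ^ k * (s - t)) ^ 2 < 1 := by rwa [sq_lt_one_iff_abs_lt_one]
  calc (s - t) ^ 2 * 2 ^ (2 * k) = (2 ^ k * (s - t)) ^ 2 := by ring
    _ ≤ 1 := h3.le

lemma auxC_le (η : ℝ × ℝ) (k : ℕ) (z : (ℝ × ℝ) × (ℝ × ℝ)) (h : auxF η k z.1 = auxF η k z.2) :
    ENNReal.ofReal (auxC z) ≤ 2 * auxW k := by
  unfold auxF at h
  rw [Prod.mk.injEq] at h
  have a := aux_floor_close k _ _ _ h.1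
  have b := aux_floor_close k _ _ _ h.2
  unfold auxW
  rw [show (2 : ENNReal) = ENNReal.ofReal 2 by simp, ← ENNReal.ofReal_mul (by norm_num)]
  apply ENNReal.ofReal_le_ofReal
  unfold auxC; linarith

lemma auxC_le0 (z : (ℝ × ℝ) × (ℝ × ℝ)) (h1 : z.1 ∈ unitSq) (h2 : z.2 ∈ unitSq) :
    ENNReal.ofReal (auxC z) ≤ 2 * auxW 0 := by
  unfold auxW
  rw [show (2 : ENNReal) = ENNReal.ofReal 2 by simp, ← ENNReal.ofReal_mul (by norm_num)]
  apply ENNReal.ofReal_le_ofReal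
  unfold auxC
  obtain ⟨⟨a1, a2⟩, ⟨a3, a4⟩⟩ := h1
  obtain ⟨⟨b1, b2⟩, ⟨b3, b4⟩⟩ := h2
  norm_num
  nlinarith

def auxD (η : ℝ × ℝ) (μ ν : Measure (ℝ × ℝ)) (k : ℕ) : ENNReal :=
  ∑' i : ℤ × ℤ, (μ (auxF η k ⁻¹' {i}) - ν (auxF η k ⁻¹' {i}))

lemma aux_main (η : ℝ × ℝ) (k : ℕ) : ∀ (μ ν : Measure (ℝ × ℝ)), IsFiniteMeasure μ →
    IsFiniteMeasure ν → μ Set.univ = ν Set.univ → (∀ᵐ x ∂μ, x ∈ unitSq) →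
    (∀ᵐ x ∂ν, x ∈ unitSq) → ∃ γ : Measure ((ℝ × ℝ) × (ℝ × ℝ)), γ.map Prod.fst = μ ∧
      γ.map Prod.snd = ν ∧ ∫⁻ z, ENNReal.ofReal (auxC z) ∂γ ≤
        2 * auxW k * μ Set.univ + ∑ j ∈ Finset.Icc 1 k, 8 * auxW j * auxD η μ ν j := by
  induction k with
  | zero =>
    intro μ ν _ _ h hμ hν
    obtain ⟨γ, ν', h1, h2⟩ := aux_cell μ ν h.le
    have hg : γ Set.univ = μ Set.univ := by
      rw [← h1, Measure.map_apply measurable_fst MeasurableSet.univ]; rfl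
    have hn : ν' = 0 := by
      rw [← Measure.measure_univ_eq_zero]
      have : γ Set.univ + ν' Set.univ = ν Set.univ := by
        rw [← h2, Measure.add_apply, Measure.map_apply measurable_snd MeasurableSet.univ]; rfl
      rw [hg, h] at this
      have h' : ν Set.univ + ν' Set.univ = ν Set.univ + 0 := by simpa using this
      exact (ENNReal.add_right_inj (measure_ne_top ν _)).1 h'
    rw [hn, add_zero] at h2
    refine ⟨γ, h1, h2, ?_⟩
    rw [← h1] at hμ
    rw [← h2] at hν
    have e1 := ae_of_ae_map measurable_fst.aemeasurable hμ
    have e2 := ae_of_ae_map measurable_snd.aemeasurable hν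
    calc ∫⁻ z, ENNReal.ofReal (auxC z) ∂γ ≤ ∫⁻ z, 2 * auxW 0 ∂γ := by
          apply lintegral_mono_ae
          filter_upwards [e1, e2] with z a b using auxC_le0 z a b
      _ = 2 * auxW 0 * μ Set.univ := by rw [lintegral_const, hg]
      _ ≤ _ := le_self_add
  | succ k ih =>
    intro μ ν _ _ h hμ hν
    obtain ⟨γ, μ', ν', h1, h2, h3, h4⟩ := aux_part (auxF η (k + 1)) (auxF_meas η (k + 1)) μ ν
    have l1 : μ' ≤ μ := by rw [← h1]; exact Measure.le_add_left le_rfl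
    have l2 : ν' ≤ ν := by rw [← h2]; exact Measure.le_add_left le_rfl
    have l3 : γ.map Prod.fst ≤ μ := by
      conv_rhs => rw [← h1]
      exact Measure.le_add_right le_rfl
    have f1 : IsFiniteMeasure μ' := isFiniteMeasure_of_le μ l1
    have f2 : IsFiniteMeasure ν' := isFiniteMeasure_of_le ν l2
    have hg : γ Set.univ = (γ.map Prod.fst) Set.univ := by
      rw [Measure.map_apply measurable_fst MeasurableSet.univ]; rfl
    have hg2 : γ Set.univ = (γ.map Prod.snd) Set.univ := by
      rw [Measure.map_apply measurable_snd MeasurableSet.univ]; rfl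
    have hgl : γ Set.univ ≤ μ Set.univ := hg ▸ l3 _
    have hgt : γ Set.univ ≠ ⊤ := ne_top_of_le_ne_top (measure_ne_top μ _) hgl
    have hm : μ' Set.univ = ν' Set.univ := by
      have : γ Set.univ + μ' Set.univ = γ Set.univ + ν' Set.univ := by
        conv_lhs => rw [hg, ← Measure.add_apply, h1]
        conv_rhs => rw [hg2, ← Measure.add_apply, h2]
        exact h
      exact (ENNReal.add_right_inj hgt).1 this
    obtain ⟨γ', g1, g2, g3⟩ := ih μ' ν' f1 f2 hm
      ((Measure.absolutelyContinuous_of_le l1).ae_le hμ)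
      ((Measure.absolutelyContinuous_of_le l2).ae_le hν)
    have cells : ∀ j ≤ k + 1, ∀ i, μ (auxF η j ⁻¹' {i}) - ν (auxF η j ⁻¹' {i}) =
        μ' (auxF η j ⁻¹' {i}) - ν' (auxF η j ⁻¹' {i}) := by
      intro j hj i
      have hA : MeasurableSet (auxF η j ⁻¹' {i}) := auxF_meas η j (measurableSet_singleton i)
      have e : γ (Prod.fst ⁻¹' (auxF η j ⁻¹' {i})) = γ (Prod.snd ⁻¹' (auxF η j ⁻¹' {i})) := by
        apply measure_congr
        filter_upwards [h3] with z hz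
        obtain ⟨n, hn⟩ := Nat.exists_eq_add_of_le hj
        rw [hn] at hz
        have := auxF_nested η j n _ _ hz
        apply propext
        change auxF η j z.1 = i ↔ auxF η j z.2 = i
        rw [this]
      conv_lhs => rw [← h1, ← h2]
      rw [Measure.add_apply, Measure.add_apply, Measure.map_apply measurable_fst hA,
        Measure.map_apply measurable_snd hA, e]
      refine ENNReal.add_sub_add_eq_sub_left ?_
      exact ne_top_of_le_ne_top hgt (measure_mono (Set.subset_univ _))
    have hD : ∀ j ≤ k + 1, auxD η μ' ν' j = auxD η μ ν j := by
      intro j hj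
      unfold auxD
      exact tsum_congr fun i => (cells j hj i).symm
    have hD1 : μ' Set.univ = auxD η μ ν (k + 1) := by
      rw [← hD _ le_rfl]
      unfold auxD
      have : (⋃ i, auxF η (k + 1) ⁻¹' {i}) = Set.univ := by ext x; simp
      rw [← this, measure_iUnion]
      · refine tsum_congr fun i => ?_
        rcases h4 i with h | h <;> simp [h]
      · intro i j hij
        exact Disjoint.preimage _ (by simpa using hij)
      · exact fun i => auxF_meas η _ (measurableSet_singleton i)
    refine ⟨γ + γ', ?_, ?_, ?_⟩
    · rw [Measure.map_add _ _ measurable_fst, g1, h1]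
    · rw [Measure.map_add _ _ measurable_snd, g2, h2]
    · rw [lintegral_add_measure, Finset.sum_Icc_succ_top (by omega)]
      have b1 : ∫⁻ z, ENNReal.ofReal (auxC z) ∂γ ≤ 2 * auxW (k + 1) * μ Set.univ := by
        calc ∫⁻ z, ENNReal.ofReal (auxC z) ∂γ ≤ ∫⁻ z, 2 * auxW (k + 1) ∂γ := by
              apply lintegral_mono_ae
              filter_upwards [h3] with z a using auxC_le η _ z a
          _ = 2 * auxW (k + 1) * γ Set.univ := by rw [lintegral_const]
          _ ≤ _ := by gcongr
      have b2 : ∑ j ∈ Finset.Icc 1 k, 8 * auxW j * auxD η μ' ν' j =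
          ∑ j ∈ Finset.Icc 1 k, 8 * auxW j * auxD η μ ν j := by
        refine Finset.sum_congr rfl fun j hj => ?_
        rw [hD j (by have := (Finset.mem_Icc.1 hj).2; omega)]
      rw [b2, hD1, auxW_succ] at g3
      calc _ ≤ _ := add_le_add b1 g3
        _ = _ := by ring

lemma aux_gridCell (η : ℝ × ℝ) (k : ℕ) (i : ℤ × ℤ) (p : Measure (ℝ × ℝ))
    (hp : ∀ᵐ x ∂p, x ∈ unitSq) : p (gridCell k η i) = p (auxF η k ⁻¹' {i}) := by
  apply measure_congr
  filter_upwards [hp] with x hx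
  apply propext
  change (x ∈ unitSq ∧ _ ∧ _) ↔ auxF η k x = i
  unfold auxF
  rw [Prod.ext_iff]
  simp [hx]

lemma aux_D_le (η : ℝ × ℝ) (k : ℕ) (p q : Measure (ℝ × ℝ)) [IsProbabilityMeasure p]
    [IsProbabilityMeasure q] (hp : ∀ᵐ x ∂p, x ∈ unitSq) (hq : ∀ᵐ x ∂q, x ∈ unitSq) :
    auxD η p q k ≤ ENNReal.ofReal
      (∑' ij : ℤ × ℤ, |(p (gridCell k η ij)).toReal - (q (gridCell k η ij)).toReal|) := by
  simp_rw [aux_gridCell η k _ p hp, aux_gridCell η k _ q hq]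
  have hs : ∀ (m : Measure (ℝ × ℝ)) [IsProbabilityMeasure m],
      Summable fun i => (m (auxF η k ⁻¹' {i})).toReal := by
    intro m _
    apply ENNReal.summable_toReal
    rw [← measure_iUnion]
    · exact measure_ne_top _ _
    · intro i j hij
      exact Disjoint.preimage _ (by simpa using hij)
    · exact fun i => auxF_meas η _ (measurableSet_singleton i)
  rw [ENNReal.ofReal_tsum_of_nonneg (fun _ => abs_nonneg _) ((hs p).sub (hs q)).abs]
  unfold auxD
  refine ENNReal.tsum_le_tsum fun i => ?_
  have : p (auxF η k ⁻¹' {i}) - q (auxF η k ⁻¹' {i}) = ENNReal.ofReal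
      ((p (auxF η k ⁻¹' {i})).toReal - (q (auxF η k ⁻¹' {i})).toReal) := by
    rw [ENNReal.ofReal_sub _ ENNReal.toReal_nonneg, ENNReal.ofReal_toReal (measure_ne_top _ _),
      ENNReal.ofReal_toReal (measure_ne_top _ _)]
  rw [this]
  exact ENNReal.ofReal_le_ofReal (le_abs_self _)

/-- (Lemma of Weed–Bach adapted to this setting.) There is an absolute
constant `C` such that for every `d ≥ 1`, every `η ∈ [0,1]²`, and all Borel probability
measures `p, q` on `[0,1]²`:
`W2(p,q)² ≤ C·(2^{−2⌈log₂ d⌉} + Σ_{k=1}^{⌈log₂ d⌉} 2^{−2k} Σ_{A ∈ Q^k(η)} |p(A) − q(A)|)`. -/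
theorem w2_sq_le_multiresolution :
    ∃ C : ℝ, 0 < C ∧ ∀ d : ℕ, 1 ≤ d → ∀ η ∈ unitSq, ∀ p q : Measure (ℝ × ℝ),
      IsProbabilityMeasure p → IsProbabilityMeasure q → p unitSq = 1 → q unitSq = 1 →
      W2 p q ^ 2 ≤ C * ((1 : ℝ) / 2 ^ (2 * Nat.clog 2 d) +
        ∑ k ∈ Finset.Icc 1 (Nat.clog 2 d), (1 : ℝ) / 2 ^ (2 * k) *
          ∑' ij : ℤ × ℤ, |(p (gridCell k η ij)).toReal - (q (gridCell k η ij)).toReal|) := by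
  refine ⟨8, by norm_num, ?_⟩
  intro d _ η _ p q hp hq hp1 hq1
  have hms : MeasurableSet unitSq := measurableSet_Icc.prod measurableSet_Icc
  have ap : ∀ᵐ x ∂p, x ∈ unitSq := (prob_compl_eq_zero_iff hms).2 hp1
  have aq : ∀ᵐ x ∂q, x ∈ unitSq := (prob_compl_eq_zero_iff hms).2 hq1
  obtain ⟨γ, h1, h2, h3⟩ := aux_main η (Nat.clog 2 d) p q inferInstance inferInstance
    (by simp) ap aq
  have hγ : IsProbabilityMeasure γ := ⟨by
    have : (γ.map Prod.fst) Set.univ = 1 := by rw [h1]; simp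
    rwa [Measure.map_apply measurable_fst MeasurableSet.univ] at this⟩
  have hn : ∀ z, 0 ≤ auxC z := fun z => by unfold auxC; positivity
  have hnn : 0 ≤ transportCost (fun x y : ℝ × ℝ => (x.1 - y.1) ^ 2 + (x.2 - y.2) ^ 2) p q := by
    apply Real.sInf_nonneg
    rintro c ⟨γ, -, -, rfl⟩
    exact integral_nonneg hn
  unfold W2
  rw [Real.sq_sqrt hnn]
  have hle : transportCost (fun x y : ℝ × ℝ => (x.1 - y.1) ^ 2 + (x.2 - y.2) ^ 2) p q
      ≤ ∫ z, auxC z ∂γ := by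
    apply csInf_le
    · refine ⟨0, ?_⟩
      rintro c ⟨γ, -, -, rfl⟩
      exact integral_nonneg hn
    · exact ⟨γ, hγ, ⟨h1, h2⟩, rfl⟩
  refine hle.trans ?_
  have hm : AEStronglyMeasurable auxC γ := by
    have : Continuous auxC := by unfold auxC; fun_prop
    exact this.aestronglyMeasurable
  rw [integral_eq_lintegral_of_nonneg_ae (Filter.Eventually.of_forall hn) hm]
  set S : ℕ → ℝ := fun k =>
    ∑' ij : ℤ × ℤ, |(p (gridCell k η ij)).toReal - (q (gridCell k η ij)).toReal| with hS
  have hS0 : ∀ k, 0 ≤ S k := fun k => tsum_nonneg fun _ => abs_nonneg _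
  apply ENNReal.toReal_le_of_le_ofReal
  · have : 0 ≤ ∑ k ∈ Finset.Icc 1 (Nat.clog 2 d), (1 : ℝ) / 2 ^ (2 * k) * S k :=
      Finset.sum_nonneg fun k _ => mul_nonneg (by positivity) (hS0 k)
    positivity
  refine h3.trans ?_
  rw [mul_add, ENNReal.ofReal_add (by positivity)
    (mul_nonneg (by norm_num) (Finset.sum_nonneg fun k _ => mul_nonneg (by positivity) (hS0 k)))]
  have e8 : ENNReal.ofReal 8 = 8 := by simp
  refine add_le_add ?_ ?_
  · rw [measure_univ, mul_one, ENNReal.ofReal_mul (by norm_num), e8]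
    unfold auxW
    gcongr
    norm_num
  · rw [Finset.mul_sum, ENNReal.ofReal_sum_of_nonneg
      (fun k _ => mul_nonneg (by norm_num) (mul_nonneg (by positivity) (hS0 k)))]
    refine Finset.sum_le_sum fun k _ => ?_
    rw [ENNReal.ofReal_mul (by norm_num), ENNReal.ofReal_mul (by positivity), e8, mul_assoc]
    have := aux_D_le η k p q ap aq
    unfold auxW
    gcongr

end
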